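/- arXiv:1703.02307 — 8 statements merged into one kernel-verified Lean document; each statement's English description precedes it below -/
import Mathlib

section
/- Let m, K ≥ 1 be integers, let 𝔯 = ((R_k, ζ_k))_{k=1,…,K} be a reference family, and let H0 ⊆ {1,…,m}. Then the following two statements are equivalent: (i) |R_k ∩ H0| ≤ ζ_k for every k ∈ {1,…,K}; (ii) for every R ⊆ {1,…,m}, |R ∩ H0| ≤ V̄_𝔯(R). -/
/-- The interpolation bound `V̄_𝔯(R) = min( min_{1≤k≤K} (|R \ R_k| + ζ_k), |R| )`
for a reference family `𝔯 = ((R_k, ζ_k))_{k=1,…,K}`. -/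
noncomputable def Vbar {m K : ℕ} (Rk : Fin K → Finset (Fin m)) (ζ : Fin K → ℕ)
    (R : Finset (Fin m)) : ℕ :=
  sInf (insert R.card (Set.range fun k : Fin K => (R \ Rk k).card + ζ k))

theorem stmt0 (m K : ℕ) (hm : 1 ≤ m) (hK : 1 ≤ K)
    (Rk : Fin K → Finset (Fin m)) (ζ : Fin K → ℕ) (H0 : Finset (Fin m)) :
    (∀ k : Fin K, (Rk k ∩ H0).card ≤ ζ k) ↔
      ∀ R : Finset (Fin m), (R ∩ H0).card ≤ Vbar Rk ζ R := by
  constructor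
  · intro h R
    refine le_csInf (Set.insert_nonempty _ _) ?_
    rintro _ (rfl | ⟨k, rfl⟩)
    · exact Finset.card_le_card Finset.inter_subset_left
    · have hsub : R ∩ H0 ⊆ (R \ Rk k) ∪ (Rk k ∩ H0) := by
        intro x hx
        by_cases hxk : x ∈ Rk k <;> simp_all
      exact (Finset.card_le_card hsub).trans
        ((Finset.card_union_le _ _).trans (Nat.add_le_add_left (h k) _))
  · intro h k
    refine (h (Rk k)).trans (Nat.sInf_le (Or.inr ⟨k, ?_⟩))
    simp
end

section
/- Let (Ω, ℱ, P) be a probability space, m, K ≥ 1 integers, and for each k ∈ {1,…,K} let R_k : Ω → 𝒫({1,…,m}) and ζ_k : Ω → ℕ be measurable maps (the σ-algebra on the finite set 𝒫({1,…,m}) being the discrete one). Let H0 ⊆ {1,…,m} be fixed and α ∈ (0,1). Then P( ∀k ∈ {1,…,K}, |R_k ∩ H0| ≤ ζ_k ) ≥ 1 − α holds if and only if P( ∀ R ⊆ {1,…,m}, |R ∩ H0| ≤ V̄_𝔯(R) ) ≥ 1 − α holds, where V̄_𝔯 is computed pointwise in ω from (R_k(ω), ζ_k(ω))_{k=1,…,K}.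 -/
open MeasureTheory

/-- The defining property of a finite infimum: `n ≤ V̄_𝔯(R)` iff `n` is below every term. -/
theorem le_Vbar_iff {m K : ℕ} (Rk : Fin K → Finset (Fin m)) (ζ : Fin K → ℕ)
    (R : Finset (Fin m)) (n : ℕ) :
    n ≤ Vbar Rk ζ R ↔ n ≤ R.card ∧ ∀ k, n ≤ (R \ Rk k).card + ζ k := by
  rw [Vbar, le_csInf_iff (OrderBot.bddBelow _) (Set.insert_nonempty _ _)]
  simp

/-- The reference family bounds the false positives of each of its members iff the interpolation
bound is valid for every set. -/
theorem forall_card_inter_le_Vbar_iff {m K : ℕ} (Rk : Fin K → Finset (Fin m)) (ζ : Fin K → ℕ)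
    (H : Finset (Fin m)) :
    (∀ R, (R ∩ H).card ≤ Vbar Rk ζ R) ↔ ∀ k, (Rk k ∩ H).card ≤ ζ k := by
  simp only [le_Vbar_iff]
  refine ⟨fun h k => by simpa using (h (Rk k)).2 k, fun h R =>
    ⟨Finset.card_le_card Finset.inter_subset_left, fun k => ?_⟩⟩
  have hsub : R ∩ H ⊆ (R \ Rk k) ∪ (Rk k ∩ H) := by
    intro x hx
    simp only [Finset.mem_inter, Finset.mem_union, Finset.mem_sdiff] at hx ⊢
    tauto
  calc (R ∩ H).card ≤ ((R \ Rk k) ∪ (Rk k ∩ H)).card := Finset.card_le_card hsub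
    _ ≤ (R \ Rk k).card + (Rk k ∩ H).card := Finset.card_union_le _ _
    _ ≤ (R \ Rk k).card + ζ k := Nat.add_le_add_left (h k) _

theorem stmt2 {Ω : Type*} [MeasurableSpace Ω] (P : Measure Ω) [IsProbabilityMeasure P]
    (m K : ℕ) (hm : 1 ≤ m) (hK : 1 ≤ K)
    (Rk : Fin K → Ω → Finset (Fin m)) (ζ : Fin K → Ω → ℕ)
    (hRmeas : ∀ (k : Fin K) (s : Finset (Fin m)), MeasurableSet {ω | Rk k ω = s})
    (hζmeas : ∀ (k : Fin K) (n : ℕ), MeasurableSet {ω | ζ k ω = n})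
    (H0 : Finset (Fin m)) (α : ℝ) (hα : α ∈ Set.Ioo (0 : ℝ) 1) :
    (ENNReal.ofReal (1 - α) ≤ P {ω | ∀ k : Fin K, (Rk k ω ∩ H0).card ≤ ζ k ω}) ↔
      (ENNReal.ofReal (1 - α) ≤ P {ω | ∀ R : Finset (Fin m),
        (R ∩ H0).card ≤ Vbar (fun k => Rk k ω) (fun k => ζ k ω) R}) := by
  simp only [forall_card_inter_le_Vbar_iff]
end

section
/- Let m, K ≥ 1 and let 𝔯 = ((R_k, ζ_k))_{k=1,…,K} be a reference family. For each k define ζ̃_k := V̄_𝔯(R_k) = min( min_{1≤j≤K} (|R_k \ R_j| + ζ_j), |R_k| ). Then the ζ̃_k satisfy the self-consistency equations: for every k ∈ {1,…,K}, ζ̃_k = min( min_{1≤j≤K} (|R_k \ R_j| + ζ̃_j), |R_k| ). -/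
theorem Vbar_le_card {m K : ℕ} (Rk : Fin K → Finset (Fin m)) (ζ : Fin K → ℕ)
    (R : Finset (Fin m)) : Vbar Rk ζ R ≤ R.card :=
  Nat.sInf_le (Set.mem_insert _ _)

theorem Vbar_le_card_sdiff_add {m K : ℕ} (Rk : Fin K → Finset (Fin m)) (ζ : Fin K → ℕ)
    (R : Finset (Fin m)) (k : Fin K) : Vbar Rk ζ R ≤ (R \ Rk k).card + ζ k :=
  Nat.sInf_le (Set.mem_insert_of_mem _ ⟨k, rfl⟩)

theorem Vbar_eq_card_or {m K : ℕ} (Rk : Fin K → Finset (Fin m)) (ζ : Fin K → ℕ)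
    (R : Finset (Fin m)) :
    Vbar Rk ζ R = R.card ∨ ∃ k, (R \ Rk k).card + ζ k = Vbar Rk ζ R :=
  Nat.sInf_mem (Set.insert_nonempty R.card (Set.range fun k : Fin K => (R \ Rk k).card + ζ k))

theorem Vbar_le_card_sdiff_add_Vbar {m K : ℕ} (Rk : Fin K → Finset (Fin m)) (ζ : Fin K → ℕ)
    (R S : Finset (Fin m)) : Vbar Rk ζ R ≤ (R \ S).card + Vbar Rk ζ S := by
  rcases Vbar_eq_card_or Rk ζ S with h | ⟨i, h⟩
  · rw [h]
    exact (Vbar_le_card Rk ζ R).trans Finset.card_le_card_sdiff_add_card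
  · have hsub : R \ Rk i ⊆ (R \ S) ∪ (S \ Rk i) := by
      intro x
      simp only [Finset.mem_sdiff, Finset.mem_union]
      tauto
    have hcard := (Finset.card_le_card hsub).trans (Finset.card_union_le _ _)
    have hR := Vbar_le_card_sdiff_add Rk ζ R i
    omega

theorem stmt5 (m K : ℕ) (hm : 1 ≤ m) (hK : 1 ≤ K)
    (Rk : Fin K → Finset (Fin m)) (ζ : Fin K → ℕ) :
    ∀ k : Fin K,
      Vbar Rk ζ (Rk k) =
        Vbar Rk (fun j => Vbar Rk ζ (Rk j)) (Rk k) := by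
  intro k
  apply le_antisymm
  · rcases Vbar_eq_card_or Rk (fun j => Vbar Rk ζ (Rk j)) (Rk k) with h | ⟨j, h⟩
    · exact h ▸ Vbar_le_card Rk ζ (Rk k)
    · exact h ▸ Vbar_le_card_sdiff_add_Vbar Rk ζ (Rk k) (Rk j)
  · simpa using Vbar_le_card_sdiff_add Rk (fun j => Vbar Rk ζ (Rk j)) (Rk k) k
end

section
/- Let m, K ≥ 1 and let 𝔯 = ((R_k, ζ_k))_{k=1,…,K} be a reference family that is nested, i.e., R_k ⊆ R_{k'} whenever 1 ≤ k ≤ k' ≤ K. Then for every R ⊆ {1,…,m}, V̄_𝔯(R) = V*_𝔯(R). -/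
/-- The optimal post hoc bound `V*_𝔯(R) = max_{A ∈ 𝒜(𝔯)} |R ∩ A|`, where
`𝒜(𝔯) = { A ⊆ {1,…,m} : ∀ k, |R_k ∩ A| ≤ ζ_k }`. -/
noncomputable def Vstar {m K : ℕ} (Rk : Fin K → Finset (Fin m)) (ζ : Fin K → ℕ)
    (R : Finset (Fin m)) : ℕ :=
  sSup {n : ℕ | ∃ A : Finset (Fin m), (∀ k : Fin K, (Rk k ∩ A).card ≤ ζ k) ∧ n = (R ∩ A).card}

theorem card_inter_le_card_sdiff_add {α : Type*} [DecidableEq α] (R S A : Finset α) :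
    (R ∩ A).card ≤ (R \ S).card + (S ∩ A).card := by
  refine (Finset.card_le_card fun x hx => ?_).trans (Finset.card_union_le _ _)
  simp only [Finset.mem_inter, Finset.mem_union, Finset.mem_sdiff] at hx ⊢
  tauto

/-- For a nested family, an inclusion-maximal subset of `R` meeting all the constraints either
is `R` itself, or contains everything of `R` outside some saturated `S k`. -/
theorem exists_subset_card_eq_of_monotone {ι α : Type*} [LinearOrder ι] [Finite ι]
    [DecidableEq α] {S : ι → Finset α} (hS : Monotone S) (ζ : ι → ℕ) (R : Finset α) :
    ∃ A ⊆ R, (∀ k, (S k ∩ A).card ≤ ζ k) ∧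
      (A = R ∨ ∃ k, A.card = (R \ S k).card + ζ k) := by
  classical
  obtain ⟨A, hA, hmax⟩ :=
    Finset.exists_max_image (R.powerset.filter fun A => ∀ k, (S k ∩ A).card ≤ ζ k) Finset.card
      ⟨∅, by simp⟩
  simp only [Finset.mem_filter, Finset.mem_powerset] at hA hmax
  obtain ⟨hAR, hfeas⟩ := hA
  refine ⟨A, hAR, hfeas, or_iff_not_imp_left.2 fun hne => ?_⟩
  have saturated : ∀ x ∈ R, x ∉ A → ∃ k, x ∈ S k ∧ (S k ∩ A).card = ζ k := by
    intro x hxR hxA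
    by_contra! h
    have hle := hmax (insert x A) ⟨Finset.insert_subset hxR hAR, fun k => ?_⟩
    · rw [Finset.card_insert_of_notMem hxA] at hle
      omega
    · by_cases hxk : x ∈ S k
      · rw [Finset.inter_insert_of_mem hxk]
        have := (hfeas k).lt_of_ne (h k hxk)
        exact (Finset.card_insert_le _ _).trans this
      · rw [Finset.inter_insert_of_notMem hxk]
        exact hfeas k
  obtain ⟨x, hxR, hxA⟩ := Finset.exists_of_ssubset (hAR.ssubset_of_ne hne)
  obtain ⟨j, -, hj⟩ := saturated x hxR hxA
  obtain ⟨k, hk, hkmax⟩ :=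
    Set.exists_max_image {k | (S k ∩ A).card = ζ k} id (Set.toFinite _) ⟨j, hj⟩
  have hsdiff : A \ S k = R \ S k := by
    refine (Finset.sdiff_subset_sdiff hAR le_rfl).antisymm fun y hy => ?_
    rw [Finset.mem_sdiff] at hy ⊢
    refine ⟨?_, hy.2⟩
    by_contra hyA
    obtain ⟨l, hyl, hl⟩ := saturated y hy.1 hyA
    exact hy.2 (hS (hkmax l hl) hyl)
  refine ⟨k, ?_⟩
  rw [← hsdiff, ← hk, Finset.inter_comm, Finset.card_sdiff_add_card_inter]

theorem stmt6 (m K : ℕ) (hm : 1 ≤ m) (hK : 1 ≤ K)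
    (Rk : Fin K → Finset (Fin m)) (ζ : Fin K → ℕ)
    (hnested : ∀ k k' : Fin K, k ≤ k' → Rk k ⊆ Rk k') :
    ∀ R : Finset (Fin m), Vbar Rk ζ R = Vstar Rk ζ R := by
  intro R
  have upper : ∀ n ∈ {n : ℕ | ∃ A : Finset (Fin m),
      (∀ k : Fin K, (Rk k ∩ A).card ≤ ζ k) ∧ n = (R ∩ A).card}, n ≤ Vbar Rk ζ R := by
    rintro n ⟨A, hA, rfl⟩
    refine le_csInf (Set.insert_nonempty _ _) ?_
    rintro b (rfl | ⟨k, rfl⟩)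
    · exact Finset.card_le_card Finset.inter_subset_left
    · exact (card_inter_le_card_sdiff_add R (Rk k) A).trans (Nat.add_le_add_left (hA k) _)
  obtain ⟨A, hAR, hfeas, hA⟩ :=
    exists_subset_card_eq_of_monotone (fun k k' h => hnested k k' h) ζ R
  have hmem : (R ∩ A).card ∈ {n : ℕ | ∃ A : Finset (Fin m),
      (∀ k : Fin K, (Rk k ∩ A).card ≤ ζ k) ∧ n = (R ∩ A).card} := ⟨A, hfeas, rfl⟩
  refine le_antisymm (le_trans ?_ (le_csSup ⟨_, upper⟩ hmem)) (csSup_le ⟨_, hmem⟩ upper)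
  rw [Finset.inter_eq_right.2 hAR]
  refine Nat.sInf_le ?_
  rcases hA with rfl | ⟨k, hk⟩
  · exact Set.mem_insert _ _
  · exact Set.mem_insert_of_mem _ ⟨k, hk.symm⟩
end

section
/- (Hommel's inequality.) Let (Ω, ℱ, P) be a probability space, m ≥ 1, and p_1,…,p_m : Ω → [0,1] measurable. Let H0 ⊆ {1,…,m} be nonempty with m0 = |H0|, and assume each i ∈ H0 satisfies P(p_i ≤ t) ≤ t for all t ∈ [0,1]. Let C_m = ∑_{i=1}^m 1/i. Then for every α ∈ (0,1), P( ∃ k ∈ {1,…,m0} : p_{(k:H0)} ≤ α k / (m0 C_m) ) ≤ α. -/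
open MeasureTheory

/-- Weights on `{1,…,n}` whose tail sums from `k` to `n` equal `1 / k`. -/
noncomputable def hommelWeight (n j : ℕ) : ℝ :=
  if j = n then 1 / (n : ℝ) else 1 / (j : ℝ) - 1 / ((j : ℝ) + 1)

lemma hommelWeight_nonneg (n j : ℕ) (hj : 1 ≤ j) : 0 ≤ hommelWeight n j := by
  unfold hommelWeight
  split_ifs
  · positivity
  · have : (0 : ℝ) < j := by exact_mod_cast hj
    exact sub_nonneg.2 (one_div_le_one_div_of_le this (by linarith))

lemma sum_hommelWeight_Icc {n k : ℕ} (hkn : k ≤ n) :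
    ∑ j ∈ Finset.Icc k n, hommelWeight n j = 1 / (k : ℝ) := by
  induction hkn using Nat.decreasingInduction with
  | self => simp [hommelWeight]
  | of_succ k hk ih =>
    rw [← Finset.insert_Icc_add_one_left_eq_Icc hk.le, Finset.sum_insert (by simp), ih]
    simp [hommelWeight, hk.ne]

lemma sum_hommelWeight_mul {n : ℕ} :
    ∑ j ∈ Finset.Icc 1 n, hommelWeight n j * (j : ℝ) =
      ∑ j ∈ Finset.Icc 1 n, 1 / (j : ℝ) := by
  have h1 : ∀ j ∈ Finset.Icc 1 n, hommelWeight n j * (j : ℝ) =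
      ∑ i ∈ Finset.Icc 1 n, if i ≤ j then hommelWeight n j else 0 := by
    intro j hj
    have : (Finset.Icc 1 n).filter (· ≤ j) = Finset.Icc 1 j := by
      ext i
      simp only [Finset.mem_filter, Finset.mem_Icc] at hj ⊢
      omega
    rw [← Finset.sum_filter, this, Finset.sum_const, Nat.card_Icc, nsmul_eq_mul, mul_comm]
    simp
  rw [Finset.sum_congr rfl h1, Finset.sum_comm]
  refine Finset.sum_congr rfl fun i hi => ?_
  have : (Finset.Icc 1 n).filter (i ≤ ·) = Finset.Icc i n := by
    ext j
    simp only [Finset.mem_filter, Finset.mem_Icc] at hi ⊢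
    omega
  rw [← Finset.sum_filter, this, sum_hommelWeight_Icc (Finset.mem_Icc.1 hi).2]

/-- **Hommel's inequality.**  If each null `p`-value is superuniform, then with
`C_m = ∑_{i=1}^m 1/i`, the probability that for some `k ∈ {1,…,m₀}` the `k`-th
smallest null `p`-value is `≤ α k / (m₀ C_m)` is at most `α`.
Here the event `p_{(k:H0)} ≤ t` is expressed through its equivalent
characterization `|{i ∈ H0 : p_i ≤ t}| ≥ k`. -/
theorem stmt7 {Ω : Type*} [MeasurableSpace Ω] (P : Measure Ω) [IsProbabilityMeasure P]
    (m : ℕ) (hm : 1 ≤ m) (p : Fin m → Ω → ℝ)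
    (hmeas : ∀ i, Measurable (p i)) (hrange : ∀ i ω, p i ω ∈ Set.Icc (0 : ℝ) 1)
    (H0 : Finset (Fin m)) (hH0 : H0.Nonempty)
    (hnull : ∀ i ∈ H0, ∀ t ∈ Set.Icc (0 : ℝ) 1, P {ω | p i ω ≤ t} ≤ ENNReal.ofReal t)
    (Cm : ℝ) (hCm : Cm = ∑ i ∈ Finset.Icc 1 m, (1 : ℝ) / (i : ℝ))
    (α : ℝ) (hα : α ∈ Set.Ioo (0 : ℝ) 1) :
    P {ω | ∃ k ∈ Finset.Icc 1 H0.card,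
        (k : ℕ) ≤ (H0.filter fun i => p i ω ≤ α * (k : ℝ) / ((H0.card : ℝ) * Cm)).card}
      ≤ ENNReal.ofReal α := by
  classical
  set n := H0.card with hn
  have hn0 : 0 < n := hH0.card_pos
  have hnm : n ≤ m := by simpa using H0.card_le_univ
  have hnR : (0 : ℝ) < n := by exact_mod_cast hn0
  have hC1 : 1 ≤ Cm := by
    rw [hCm]
    have := Finset.single_le_sum (f := fun i : ℕ => (1 : ℝ) / (i : ℝ)) (s := Finset.Icc 1 m)
      (fun i _ => by positivity) (Finset.mem_Icc.2 ⟨le_rfl, hm⟩)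
    simpa using this
  have hC0 : 0 < Cm := by linarith
  let A : Fin m → ℕ → Set Ω := fun i j => {ω | p i ω ≤ α * (j : ℝ) / ((n : ℝ) * Cm)}
  have hA : ∀ i j, MeasurableSet (A i j) := fun i j => measurableSet_le (hmeas i) measurable_const
  let b : ℕ → ENNReal := fun j => ENNReal.ofReal (hommelWeight n j)
  let f : Ω → ENNReal := fun ω =>
    ∑ i ∈ H0, ∑ j ∈ Finset.Icc 1 n, (A i j).indicator (fun _ => b j) ω
  have hf : Measurable f := Finset.measurable_fun_sum _ fun i _ =>
    Finset.measurable_fun_sum _ fun j _ => measurable_const.indicator (hA i j)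
  refine (meas_le_lintegral₀ hf.aemeasurable ?_).trans ?_
  · rintro ω ⟨k, hk, hcard⟩
    rw [Finset.mem_Icc] at hk
    have hkR : (0 : ℝ) < k := by exact_mod_cast hk.1
    set S := H0.filter fun i => p i ω ≤ α * (k : ℝ) / ((n : ℝ) * Cm) with hS
    have hb : ∑ j ∈ Finset.Icc k n, b j = ENNReal.ofReal (1 / (k : ℝ)) := by
      rw [← sum_hommelWeight_Icc hk.2, ENNReal.ofReal_sum_of_nonneg]
      exact fun j hj => hommelWeight_nonneg n j (hk.1.trans (Finset.mem_Icc.1 hj).1)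
    calc (1 : ENNReal) = (k : ENNReal) * ENNReal.ofReal (1 / (k : ℝ)) := by
          rw [← ENNReal.ofReal_natCast, ← ENNReal.ofReal_mul hkR.le, mul_one_div_cancel hkR.ne',
            ENNReal.ofReal_one]
      _ ≤ (S.card : ENNReal) * ENNReal.ofReal (1 / (k : ℝ)) := by gcongr
      _ = ∑ i ∈ S, ∑ j ∈ Finset.Icc k n, b j := by
          rw [hb, Finset.sum_const, nsmul_eq_mul]
      _ = ∑ i ∈ S, ∑ j ∈ Finset.Icc k n, (A i j).indicator (fun _ => b j) ω := by
          refine Finset.sum_congr rfl fun i hi => Finset.sum_congr rfl fun j hj => ?_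
          have hkj : (k : ℝ) ≤ j := by exact_mod_cast (Finset.mem_Icc.1 hj).1
          have hα0 := hα.1.le
          have hmem : ω ∈ A i j := by
            refine (Finset.mem_filter.1 hi).2.trans ?_
            gcongr
          rw [Set.indicator_of_mem hmem]
      _ ≤ ∑ i ∈ S, ∑ j ∈ Finset.Icc 1 n, (A i j).indicator (fun _ => b j) ω :=
          Finset.sum_le_sum fun i _ =>
            Finset.sum_le_sum_of_subset (Finset.Icc_subset_Icc_left hk.1)
      _ ≤ f ω := Finset.sum_le_sum_of_subset (Finset.filter_subset _ _)
  · have hprob : ∀ i ∈ H0, ∀ j ∈ Finset.Icc 1 n,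
        b j * P (A i j) ≤ ENNReal.ofReal (hommelWeight n j * j * (α / (n * Cm))) := by
      intro i hi j hj
      rw [Finset.mem_Icc] at hj
      have hjn : (j : ℝ) ≤ n := by exact_mod_cast hj.2
      have hα0 := hα.1.le
      have ht : α * (j : ℝ) / ((n : ℝ) * Cm) ∈ Set.Icc (0 : ℝ) 1 := by
        refine ⟨by positivity, (div_le_one (by positivity)).2 ?_⟩
        rw [mul_comm (n : ℝ)]
        exact mul_le_mul (hα.2.le.trans hC1) hjn (by positivity) hC0.le
      refine (mul_le_mul_right (hnull i hi _ ht) (b j)).trans_eq ?_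
      rw [← ENNReal.ofReal_mul (hommelWeight_nonneg n j hj.1)]
      congr 1
      ring
    have hsum : ∑ j ∈ Finset.Icc 1 n, hommelWeight n j * j * (α / (n * Cm)) ≤ α / n := by
      rw [← Finset.sum_mul, sum_hommelWeight_mul]
      have hle : ∑ j ∈ Finset.Icc 1 n, 1 / (j : ℝ) ≤ Cm := by
        rw [hCm]
        exact Finset.sum_le_sum_of_subset_of_nonneg (Finset.Icc_subset_Icc_right hnm)
          fun _ _ _ => one_div_nonneg.2 (Nat.cast_nonneg _)
      have hα0 := hα.1.le
      calc _ ≤ Cm * (α / (n * Cm)) := by gcongr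
        _ = α / n := by field_simp
    calc ∫⁻ ω, f ω ∂P = ∑ i ∈ H0, ∑ j ∈ Finset.Icc 1 n, b j * P (A i j) := by
          rw [lintegral_finsetSum _ fun i _ => Finset.measurable_fun_sum _ fun j _ =>
            measurable_const.indicator (hA i j)]
          refine Finset.sum_congr rfl fun i _ => ?_
          rw [lintegral_finsetSum _ fun j _ => measurable_const.indicator (hA i j)]
          exact Finset.sum_congr rfl fun j _ => lintegral_indicator_const (hA i j) _
      _ ≤ ∑ i ∈ H0, ENNReal.ofReal (α / n) := by
          refine Finset.sum_le_sum fun i hi => (Finset.sum_le_sum (hprob i hi)).trans ?_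
          rw [← ENNReal.ofReal_sum_of_nonneg]
          · exact ENNReal.ofReal_le_ofReal hsum
          · intro j hj
            have := hommelWeight_nonneg n j (Finset.mem_Icc.1 hj).1
            have hα0 := hα.1.le
            positivity
      _ = ENNReal.ofReal α := by
          rw [Finset.sum_const, nsmul_eq_mul, ← hn, ← ENNReal.ofReal_natCast,
            ← ENNReal.ofReal_mul hnR.le, mul_div_cancel₀ _ hnR.ne']
end

section
/- (Single-step JER control by λ-calibration.) Let (Ω, ℱ, P) be a probability space, m, K ≥ 1, p_1,…,p_m : Ω → [0,1] measurable, H0 ⊆ {1,…,m} nonempty with m0 = |H0|, (t_k)_{1≤k≤K} a template of size K, and α ∈ (0,1). Let Λ : 𝒫({1,…,m}) → (Ω → [0,1]) assign to each subset A a measurable function Λ(A), such that: (i) for all A ⊆ A' ⊆ {1,…,m} and all ω, Λ(A')(ω) ≤ Λ(A)(ω); and (ii) P( min_{1≤k≤min(K,m0)} t_k^{-1}( p_{(k:H0)} ) < Λ(H0) ) ≤ α. Then P( ∃ k ∈ {1,…, min(K,m0)} : p_{(k:H0)} < t_k( Λ({1,…,m}) ) ) ≤ α. -/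
open MeasureTheory Filter

/-- `orderStat A f k` is the `k`-th smallest element (1-based) of the multiset
`{f(i) : i ∈ A}`. -/
noncomputable def orderStat {m : ℕ} (A : Finset (Fin m)) (f : Fin m → ℝ) (k : ℕ) : ℝ :=
  ((A.val.map f).sort (· ≤ ·)).getD (k - 1) 0

/-- Generalized inverse `t⁻¹(y) = max{x ∈ [0,1] : t(x) ≤ y}` of a template function,
expressed as a supremum. -/
noncomputable def tinv (t : ℝ → ℝ) (y : ℝ) : ℝ :=
  sSup {x | x ∈ Set.Icc (0 : ℝ) 1 ∧ t x ≤ y}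

/-- `Psi t K A f = min_{1 ≤ k ≤ min(K,|A|)} t_k⁻¹( f_{(k:A)} )`. -/
noncomputable def Psi {m : ℕ} (t : ℕ → ℝ → ℝ) (K : ℕ) (A : Finset (Fin m))
    (f : Fin m → ℝ) : ℝ :=
  sInf ((fun k => tinv (t k) (orderStat A f k)) '' Set.Icc 1 (min K A.card))

/-- An entry of a sorted list lies below `c` if more than `n` entries of the list do. -/
theorem getElem_lt_of_lt_countP {l : List ℝ} (hl : l.Pairwise (· ≤ ·)) {n : ℕ}
    (hn : n < l.length) {c : ℝ} (hc : n < l.countP (fun x => decide (x < c))) : l[n] < c := by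
  by_contra! h
  have hdrop : (l.drop n).countP (fun x => decide (x < c)) = 0 := by
    rw [List.countP_eq_zero]
    intro x hx
    obtain ⟨j, hj, rfl⟩ := List.mem_iff_getElem.mp hx
    rw [List.length_drop] at hj
    have hle : l[n] ≤ l[n + j] := by
      rcases Nat.eq_zero_or_pos j with rfl | hpos
      · exact le_rfl
      · exact List.pairwise_iff_getElem.mp hl n (n + j) hn (by omega) (by omega)
    simpa using h.trans hle
  have htake : (l.take n).countP (fun x => decide (x < c)) ≤ n :=
    List.countP_le_length.trans (by simp)
  rw [← List.take_append_drop n l, List.countP_append, hdrop] at hc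
  omega

theorem orderStat_mem_image {m : ℕ} (A : Finset (Fin m)) (f : Fin m → ℝ) {k : ℕ}
    (hk : 1 ≤ k) (hkA : k ≤ A.card) : ∃ i ∈ A, f i = orderStat A f k := by
  have hlen : k - 1 < ((A.val.map f).sort (· ≤ ·)).length := by
    rw [Multiset.length_sort, Multiset.card_map, Finset.card_val]
    omega
  have hmem := List.getElem_mem hlen
  rw [Multiset.mem_sort, Multiset.mem_map] at hmem
  rw [orderStat, List.getD_eq_getElem _ _ hlen]
  exact hmem

theorem orderStat_lt_of_le_card_filter {m : ℕ} (A : Finset (Fin m)) (f : Fin m → ℝ) {k : ℕ}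
    (hk : 1 ≤ k) {c : ℝ} (hc : k ≤ (A.filter fun i => f i < c).card) :
    orderStat A f k < c := by
  have hkA : k ≤ A.card := hc.trans (Finset.card_filter_le _ _)
  have hlen : k - 1 < ((A.val.map f).sort (· ≤ ·)).length := by
    rw [Multiset.length_sort, Multiset.card_map, Finset.card_val]
    omega
  have hcount : ((A.val.map f).sort (· ≤ ·)).countP (fun x => decide (x < c))
      = (A.filter fun i => f i < c).card := by
    rw [← Multiset.coe_countP, Multiset.sort_eq, Multiset.countP_map]
    rfl
  rw [orderStat, List.getD_eq_getElem _ _ hlen]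
  refine getElem_lt_of_lt_countP (Multiset.pairwise_sort _ _) hlen ?_
  rw [hcount]
  omega

theorem tinv_lt_of_lt {t : ℝ → ℝ} (ht0 : t 0 = 0) (htmono : MonotoneOn t (Set.Icc (0 : ℝ) 1))
    {x y : ℝ} (hx : x ∈ Set.Icc (0 : ℝ) 1)
    (htlc : x ∈ Set.Ioc (0 : ℝ) 1 →
      Tendsto t (nhdsWithin x (Set.Ico (0 : ℝ) x)) (nhds (t x)))
    (hy : 0 ≤ y) (hyx : y < t x) : tinv t y < x := by
  have hx0 : 0 < x := by
    refine hx.1.lt_of_ne ?_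
    rintro rfl
    linarith
  have hne : (nhdsWithin x (Set.Ico (0 : ℝ) x)).NeBot := by
    rw [nhdsWithin_Ico_eq_nhdsLT hx0]
    infer_instance
  obtain ⟨z, hyz, hz⟩ :=
    (((htlc ⟨hx0, hx.2⟩).eventually (lt_mem_nhds hyx)).and self_mem_nhdsWithin).exists
  refine lt_of_le_of_lt (Real.sSup_le ?_ hz.1) hz.2
  rintro w ⟨hw, hwy⟩
  by_contra! hzw
  have := htmono ⟨hz.1, hz.2.le.trans hx.2⟩ hw hzw.le
  linarith

/-- **Single-step JER control by λ-calibration.**  If `Λ` is nonincreasing in `A` and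
`P( min_k t_k⁻¹(p_{(k:H0)}) < Λ(H0) ) ≤ α`, then
`P( ∃ k ≤ min(K,m₀) : p_{(k:H0)} < t_k(Λ({1,…,m})) ) ≤ α`. -/
theorem stmt13 {Ω : Type*} [MeasurableSpace Ω] (P : Measure Ω) [IsProbabilityMeasure P]
    (m K : ℕ) (hm : 1 ≤ m) (hK : 1 ≤ K)
    (p : Fin m → Ω → ℝ) (hmeas : ∀ i, Measurable (p i))
    (hrange : ∀ i ω, p i ω ∈ Set.Icc (0 : ℝ) 1)
    (H0 : Finset (Fin m)) (hH0 : H0.Nonempty)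
    (t : ℕ → ℝ → ℝ)
    (htmap : ∀ k ∈ Finset.Icc 1 K, ∀ x ∈ Set.Icc (0 : ℝ) 1, t k x ∈ Set.Icc (0 : ℝ) 1)
    (ht0 : ∀ k ∈ Finset.Icc 1 K, t k 0 = 0)
    (htmono : ∀ k ∈ Finset.Icc 1 K, MonotoneOn (t k) (Set.Icc (0 : ℝ) 1))
    (htlc : ∀ k ∈ Finset.Icc 1 K, ∀ x ∈ Set.Ioc (0 : ℝ) 1,
      Tendsto (t k) (nhdsWithin x (Set.Ico (0 : ℝ) x)) (nhds (t k x)))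
    (α : ℝ) (hα : α ∈ Set.Ioo (0 : ℝ) 1)
    (Λ : Finset (Fin m) → Ω → ℝ)
    (hΛmeas : ∀ A, Measurable (Λ A))
    (hΛrange : ∀ A ω, Λ A ω ∈ Set.Icc (0 : ℝ) 1)
    (hΛmono : ∀ A A' : Finset (Fin m), A ⊆ A' → ∀ ω, Λ A' ω ≤ Λ A ω)
    (hcal : P {ω | Psi t K H0 (fun i => p i ω) < Λ H0 ω} ≤ ENNReal.ofReal α) :
    P {ω | ∃ k ∈ Finset.Icc 1 (min K H0.card),
        (k : ℕ) ≤ (H0.filter fun i => p i ω < t k (Λ Finset.univ ω)).card}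
      ≤ ENNReal.ofReal α := by
  refine (measure_mono ?_).trans hcal
  rintro ω ⟨k, hk, hcard⟩
  rw [Finset.mem_Icc] at hk
  have hkK : k ∈ Finset.Icc 1 K := Finset.mem_Icc.mpr ⟨hk.1, hk.2.trans (min_le_left _ _)⟩
  obtain ⟨i, -, hi⟩ :=
    orderStat_mem_image H0 (fun i => p i ω) hk.1 (hk.2.trans (min_le_right _ _))
  have hnonneg : 0 ≤ orderStat H0 (fun i => p i ω) k := hi ▸ (hrange i ω).1
  have hlt := tinv_lt_of_lt (ht0 k hkK) (htmono k hkK) (hΛrange Finset.univ ω)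
    (htlc k hkK _) hnonneg (orderStat_lt_of_le_card_filter H0 (fun i => p i ω) hk.1 hcard)
  have hle : Psi t K H0 (fun i => p i ω) ≤ tinv (t k) (orderStat H0 (fun i => p i ω) k) :=
    csInf_le ((Set.finite_Icc _ _).image _).bddBelow (Set.mem_image_of_mem _ hk)
  exact (hle.trans_lt hlt).trans_le (hΛmono H0 Finset.univ (Finset.subset_univ _) ω)
end

section
/- (Step-down JER control.) Let (Ω, ℱ, P), m, K ≥ 1, p_1,…,p_m : Ω → [0,1] measurable, H0 ⊆ {1,…,m} nonempty with m0 = |H0|, (t_k)_{1≤k≤K} a template of size K, α ∈ (0,1), and Λ a λ-calibration, i.e., Λ assigns to each A ⊆ {1,…,m} a measurable function Λ(A) : Ω → [0,1] with: (i) A ⊆ A' implies Λ(A')(ω) ≤ Λ(A)(ω) for all ω; and (ii) P( min_{1≤k≤min(K,m0)} t_k^{-1}( p_{(k:H0)} ) < Λ(H0) ) ≤ α. Define pointwise in ω the sets A^{(0)} = {1,…,m} and A^{(j+1)}(ω) = { i : p_i(ω) ≥ t_1( Λ(A^{(j)}(ω))(ω) ) } for j ≥ 0. Then the sequence (A^{(j)}(ω))_{j≥0}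 is nonincreasing (so it is constant for j ≥ m); with Â(ω) := A^{(m)}(ω), one has P( ∃ k ∈ {1,…, min(K,m0)} : p_{(k:H0)} < t_k( Λ(Â) ) ) ≤ α. -/
open MeasureTheory Filter

/-- Step-down sequence: `A⁽⁰⁾ = {1,…,m}` and
`A⁽ʲ⁺¹⁾(ω) = { i : p_i(ω) ≥ t₁(Λ(A⁽ʲ⁾(ω))(ω)) }`. -/
noncomputable def Aseq {Ω : Type*} {m : ℕ} (p : Fin m → Ω → ℝ) (t1 : ℝ → ℝ)
    (Λ : Finset (Fin m) → Ω → ℝ) : ℕ → Ω → Finset (Fin m)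
  | 0, _ => Finset.univ
  | (j + 1), ω => Finset.univ.filter fun i => t1 (Λ (Aseq p t1 Λ j ω) ω) ≤ p i ω

/-- A value lying below the generalized inverse of `y` is mapped below `y`, by left-continuity. -/
theorem apply_le_of_le_tinv {t : ℝ → ℝ} {x y : ℝ} (h0 : t 0 = 0)
    (hmono : MonotoneOn t (Set.Icc (0 : ℝ) 1))
    (hlc : ∀ x ∈ Set.Ioc (0 : ℝ) 1, Tendsto t (nhdsWithin x (Set.Ico (0 : ℝ) x)) (nhds (t x)))
    (hx : x ∈ Set.Icc (0 : ℝ) 1) (hy : 0 ≤ y) (hxy : x ≤ tinv t y) : t x ≤ y := by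
  rcases hx.1.eq_or_lt with rfl | hpos
  · rwa [h0]
  have hlt : ∀ z ∈ Set.Ico (0 : ℝ) x, t z ≤ y := by
    intro z hz
    have hne : {x | x ∈ Set.Icc (0 : ℝ) 1 ∧ t x ≤ y}.Nonempty :=
      ⟨0, ⟨le_rfl, zero_le_one⟩, by rwa [h0]⟩
    obtain ⟨w, ⟨hw, hwy⟩, hzw⟩ := exists_lt_of_lt_csSup hne (hz.2.trans_le hxy)
    exact (hmono ⟨hz.1, hz.2.le.trans hx.2⟩ hw hzw.le).trans hwy
  have : (nhdsWithin x (Set.Ico (0 : ℝ) x)).NeBot := by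
    rw [← mem_closure_iff_nhdsWithin_neBot, closure_Ico hpos.ne]
    exact ⟨hpos.le, le_rfl⟩
  exact le_of_tendsto (hlc x ⟨hpos, hx.2⟩)
    (eventually_nhdsWithin_of_forall hlt)

theorem exists_mem_orderStat_eq {m : ℕ} {A : Finset (Fin m)} (f : Fin m → ℝ) {k : ℕ}
    (hk1 : 1 ≤ k) (hk : k ≤ A.card) : ∃ i ∈ A, f i = orderStat A f k := by
  have hlen : k - 1 < ((A.val.map f).sort (· ≤ ·)).length := by
    simp only [Multiset.length_sort, Multiset.card_map, Finset.card_val]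
    omega
  have hmem := List.getElem_mem hlen
  rw [Multiset.mem_sort, Multiset.mem_map] at hmem
  obtain ⟨i, hi, hfi⟩ := hmem
  exact ⟨i, hi, by rw [hfi, orderStat, List.getD_eq_getElem _ _ hlen]⟩

/-- Fewer than `k` values lie strictly below a lower bound of the `k`-th order statistic. -/
theorem card_filter_lt_of_le_orderStat {m : ℕ} {A : Finset (Fin m)} {f : Fin m → ℝ} {k : ℕ}
    {c : ℝ} (hk1 : 1 ≤ k) (hk : k ≤ A.card) (hc : c ≤ orderStat A f k) :
    (A.filter fun i => f i < c).card < k := by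
  set l := (A.val.map f).sort (· ≤ ·) with hl
  have hlen : k - 1 < l.length := by
    simp only [hl, Multiset.length_sort, Multiset.card_map, Finset.card_val]
    omega
  have hcard : (A.filter fun i => f i < c).card = l.countP (· < c) := by
    rw [← Multiset.coe_countP, hl, Multiset.sort_eq, Multiset.countP_map]
    rfl
  have hsorted : l.Pairwise (· ≤ ·) := Multiset.pairwise_sort _ _
  have hdrop : (l.drop (k - 1)).countP (· < c) = 0 := by
    rw [List.countP_eq_zero]
    intro a ha
    obtain ⟨n, hn, rfl⟩ := List.getElem_of_mem ha
    rw [orderStat, ← hl, List.getD_eq_getElem _ _ hlen] at hc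
    rw [List.getElem_drop]
    have := hsorted.sortedLE.getElem_le_getElem_of_le (i := k - 1) (j := k - 1 + n)
      (hi := hlen) (hj := by rw [List.length_drop] at hn; omega) (by omega)
    simpa using hc.trans this
  have htake : (l.take (k - 1)).countP (· < c) ≤ k - 1 :=
    List.countP_le_length.trans (List.length_take_le _ _)
  rw [hcard, ← List.take_append_drop (k - 1) l, List.countP_append, hdrop]
  omega

theorem Psi_le_tinv_orderStat {m : ℕ} (t : ℕ → ℝ → ℝ) (K : ℕ) (A : Finset (Fin m))
    (f : Fin m → ℝ) {k : ℕ} (hk : k ∈ Set.Icc 1 (min K A.card)) :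
    Psi t K A f ≤ tinv (t k) (orderStat A f k) :=
  csInf_le ((Set.finite_Icc _ _).image _).bddBelow (Set.mem_image_of_mem _ hk)

section StepDown

variable {Ω : Type*} {m : ℕ} {p : Fin m → Ω → ℝ} {t1 : ℝ → ℝ} {Λ : Finset (Fin m) → Ω → ℝ}

theorem Aseq_succ_subset (hmono : MonotoneOn t1 (Set.Icc (0 : ℝ) 1))
    (hΛrange : ∀ A ω, Λ A ω ∈ Set.Icc (0 : ℝ) 1)
    (hΛmono : ∀ A A' : Finset (Fin m), A ⊆ A' → ∀ ω, Λ A' ω ≤ Λ A ω) (ω : Ω) (j : ℕ) :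
    Aseq p t1 Λ (j + 1) ω ⊆ Aseq p t1 Λ j ω := by
  induction j with
  | zero => exact Finset.subset_univ _
  | succ j ih =>
    intro i hi
    rw [Aseq, Finset.mem_filter] at hi ⊢
    refine ⟨Finset.mem_univ _, le_trans ?_ hi.2⟩
    exact hmono (hΛrange _ _) (hΛrange _ _) (hΛmono _ _ ih ω)

theorem Aseq_succ_congr {ω : Ω} {i j : ℕ} (h : Aseq p t1 Λ i ω = Aseq p t1 Λ j ω) :
    Aseq p t1 Λ (i + 1) ω = Aseq p t1 Λ (j + 1) ω := by
  simp only [Aseq, h]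

theorem Aseq_eq_of_le {ω : Ω} (hsub : ∀ j, Aseq p t1 Λ (j + 1) ω ⊆ Aseq p t1 Λ j ω) {j : ℕ}
    (hj : m ≤ j) : Aseq p t1 Λ j ω = Aseq p t1 Λ m ω := by
  have key : ∀ j, Aseq p t1 Λ (j + 1) ω = Aseq p t1 Λ j ω ∨
      (Aseq p t1 Λ (j + 1) ω).card + (j + 1) ≤ m := by
    intro j
    induction j with
    | zero =>
      refine (hsub 0).eq_or_ssubset.imp_right fun h => ?_
      have := Finset.card_lt_card h
      simp only [Aseq, Finset.card_univ, Fintype.card_fin] at this ⊢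
      omega
    | succ j ih =>
      rcases ih with ih | ih
      · exact Or.inl (Aseq_succ_congr ih)
      · refine (hsub (j + 1)).eq_or_ssubset.imp_right fun h => ?_
        have := Finset.card_lt_card h
        omega
  have hstep : Aseq p t1 Λ (m + 1) ω = Aseq p t1 Λ m ω :=
    (key m).resolve_right (by omega)
  induction j, hj using Nat.le_induction with
  | base => rfl
  | succ j _ ih => exact (Aseq_succ_congr ih).trans hstep

/-- A set whose values all exceed the threshold `t1 x`, for every `x ≤ Λ H0`, survives every
step. -/
theorem subset_Aseq {H0 : Finset (Fin m)} {ω : Ω}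
    (hΛmono : ∀ A A' : Finset (Fin m), A ⊆ A' → ∀ ω, Λ A' ω ≤ Λ A ω)
    (h : ∀ A, Λ A ω ≤ Λ H0 ω → ∀ i ∈ H0, t1 (Λ A ω) ≤ p i ω) (j : ℕ) :
    H0 ⊆ Aseq p t1 Λ j ω := by
  induction j with
  | zero => exact Finset.subset_univ _
  | succ j ih =>
    intro i hi
    simp only [Aseq, Finset.mem_filter, Finset.mem_univ, true_and]
    exact h _ (hΛmono _ _ ih ω) i hi

end StepDown

/-- **Step-down JER control.**  The step-down sequence is nonincreasing (hence constant
from index `m` on), and with `Â = A⁽ᵐ⁾`,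
`P( ∃ k ≤ min(K,m₀) : p_{(k:H0)} < t_k(Λ(Â)) ) ≤ α`. -/
theorem stmt14 {Ω : Type*} [MeasurableSpace Ω] (P : Measure Ω) [IsProbabilityMeasure P]
    (m K : ℕ) (hm : 1 ≤ m) (hK : 1 ≤ K)
    (p : Fin m → Ω → ℝ) (hmeas : ∀ i, Measurable (p i))
    (hrange : ∀ i ω, p i ω ∈ Set.Icc (0 : ℝ) 1)
    (H0 : Finset (Fin m)) (hH0 : H0.Nonempty)
    (t : ℕ → ℝ → ℝ)
    (htmap : ∀ k ∈ Finset.Icc 1 K, ∀ x ∈ Set.Icc (0 : ℝ) 1, t k x ∈ Set.Icc (0 : ℝ) 1)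
    (ht0 : ∀ k ∈ Finset.Icc 1 K, t k 0 = 0)
    (htmono : ∀ k ∈ Finset.Icc 1 K, MonotoneOn (t k) (Set.Icc (0 : ℝ) 1))
    (htlc : ∀ k ∈ Finset.Icc 1 K, ∀ x ∈ Set.Ioc (0 : ℝ) 1,
      Tendsto (t k) (nhdsWithin x (Set.Ico (0 : ℝ) x)) (nhds (t k x)))
    (α : ℝ) (hα : α ∈ Set.Ioo (0 : ℝ) 1)
    (Λ : Finset (Fin m) → Ω → ℝ)
    (hΛmeas : ∀ A, Measurable (Λ A))
    (hΛrange : ∀ A ω, Λ A ω ∈ Set.Icc (0 : ℝ) 1)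
    (hΛmono : ∀ A A' : Finset (Fin m), A ⊆ A' → ∀ ω, Λ A' ω ≤ Λ A ω)
    (hcal : P {ω | Psi t K H0 (fun i => p i ω) < Λ H0 ω} ≤ ENNReal.ofReal α) :
    (∀ (ω : Ω) (j : ℕ), Aseq p (t 1) Λ (j + 1) ω ⊆ Aseq p (t 1) Λ j ω) ∧
    (∀ (ω : Ω) (j : ℕ), m ≤ j → Aseq p (t 1) Λ j ω = Aseq p (t 1) Λ m ω) ∧
    P {ω | ∃ k ∈ Finset.Icc 1 (min K H0.card),
        (k : ℕ) ≤ (H0.filter fun i => p i ω < t k (Λ (Aseq p (t 1) Λ m ω) ω)).card}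
      ≤ ENNReal.ofReal α := by
  have hsub := Aseq_succ_subset (p := p) (htmono 1 (Finset.mem_Icc.2 ⟨le_rfl, hK⟩)) hΛrange hΛmono
  refine ⟨hsub, fun ω j => Aseq_eq_of_le (hsub ω), (measure_mono fun ω hω => ?_).trans hcal⟩
  by_contra hψ
  simp only [Set.mem_ofPred_eq, not_lt] at hψ
  have hcard : ∀ A, Λ A ω ≤ Λ H0 ω → ∀ k ∈ Finset.Icc 1 (min K H0.card),
      (H0.filter fun i => p i ω < t k (Λ A ω)).card < k := by
    intro A hA k hk
    obtain ⟨hk1, hk2⟩ := Finset.mem_Icc.1 hk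
    have hkK : k ∈ Finset.Icc 1 K := Finset.mem_Icc.2 ⟨hk1, hk2.trans (min_le_left _ _)⟩
    have hkH : k ≤ H0.card := hk2.trans (min_le_right _ _)
    obtain ⟨i, -, hi⟩ := exists_mem_orderStat_eq (fun i => p i ω) hk1 hkH
    refine card_filter_lt_of_le_orderStat hk1 hkH
      (apply_le_of_le_tinv (ht0 k hkK) (htmono k hkK) (htlc k hkK) (hΛrange A ω)
        (hi ▸ (hrange i ω).1) ?_)
    exact hA.trans (hψ.trans (Psi_le_tinv_orderStat t K H0 _ ⟨hk1, hk2⟩))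
  have hH0sub : H0 ⊆ Aseq p (t 1) Λ m ω := by
    refine subset_Aseq hΛmono (fun A hA i hi => ?_) m
    have := hcard A hA 1 (Finset.mem_Icc.2 ⟨le_rfl, le_min hK hH0.card_pos⟩)
    rw [Nat.lt_one_iff, Finset.card_eq_zero, Finset.filter_eq_empty_iff] at this
    exact not_lt.1 (this hi)
  obtain ⟨k, hk, hle⟩ := hω
  exact (hcard _ (hΛmono _ _ hH0sub ω) k hk).not_ge hle
end

section
/- Let B ≥ 1 and let (Y_1,…,Y_B) be an exchangeable real-valued random vector, i.e., for every permutation σ of {1,…,B}, (Y_{σ(1)},…,Y_{σ(B)}) has the same joint distribution as (Y_1,…,Y_B). Then for every α ∈ [0,1), P( |{ j ∈ {1,…,B} : Y_j ≤ Y_1 }| ≤ αB ) ≤ ⌊αB⌋ / B. -/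
open MeasureTheory

/-- At most `k` coordinates of a real vector have at most `k` coordinates below or equal to them. -/
lemma card_filter_card_filter_le_le {ι : Type*} [Fintype ι] (y : ι → ℝ) (k : ℕ) :
    (Finset.univ.filter fun i => (Finset.univ.filter fun j => y j ≤ y i).card ≤ k).card ≤ k := by
  set S := Finset.univ.filter fun i => (Finset.univ.filter fun j => y j ≤ y i).card ≤ k with hS
  rcases S.eq_empty_or_nonempty with h | h
  · simp [h]
  · obtain ⟨i, hi, hmax⟩ := S.exists_max_image y h
    refine (Finset.card_le_card fun j hj => ?_).trans (Finset.mem_filter.mp hi).2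
    exact Finset.mem_filter.mpr ⟨Finset.mem_univ j, hmax j hj⟩

lemma measurableSet_card_filter_le {ι : Type*} [Fintype ι] (i : ι) (k : ℕ) :
    MeasurableSet {y : ι → ℝ | (Finset.univ.filter fun j => y j ≤ y i).card ≤ k} := by
  have h : Measurable fun y : ι → ℝ => (Finset.univ.filter fun j => y j ≤ y i).card := by
    simp only [Finset.card_filter]
    exact Finset.measurable_sum _ fun j _ => Measurable.ite
      (measurableSet_le (measurable_pi_apply j) (measurable_pi_apply i))
      measurable_const measurable_const
  exact h measurableSet_Iic

/-- If no point belongs to more than `k` of the sets `A i`, their total mass is at most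
`k`. -/
lemma sum_measure_le_of_card_filter_le {Ω ι : Type*} [MeasurableSpace Ω] [Fintype ι]
    (P : Measure Ω) [IsProbabilityMeasure P] (A : ι → Set Ω) (hA : ∀ i, MeasurableSet (A i))
    [∀ ω, DecidablePred fun i => ω ∈ A i]
    (k : ℕ) (hk : ∀ ω, (Finset.univ.filter fun i => ω ∈ A i).card ≤ k) :
    ∑ i, P (A i) ≤ k := by
  calc ∑ i, P (A i) = ∫⁻ ω, ∑ i, (A i).indicator 1 ω ∂P := by
        rw [lintegral_finsetSum _ fun i _ => measurable_one.indicator (hA i)]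
        simp [hA]
    _ ≤ ∫⁻ _, (k : ENNReal) ∂P := by
        refine lintegral_mono fun ω => ?_
        have h : ∑ i, (A i).indicator (1 : Ω → ENNReal) ω
            = ((Finset.univ.filter fun i => ω ∈ A i).card : ENNReal) := by
          simp [Set.indicator_apply, Finset.sum_boole]
        rw [h]
        exact Nat.cast_le.2 (hk ω)
    _ = k := by simp

/-- For an exchangeable real random vector `(Y_1,…,Y_B)` and `α ∈ [0,1)`,
`P( |{j : Y_j ≤ Y_1}| ≤ αB ) ≤ ⌊αB⌋ / B`. -/
theorem stmt17 {Ω : Type*} [MeasurableSpace Ω] (P : Measure Ω) [IsProbabilityMeasure P]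
    (B : ℕ) (hB : 1 ≤ B) (Y : Fin B → Ω → ℝ) (hmeas : ∀ j, Measurable (Y j))
    (hexch : ∀ σ : Equiv.Perm (Fin B),
      Measure.map (fun ω => fun j => Y (σ j) ω) P = Measure.map (fun ω => fun j => Y j ω) P)
    (α : ℝ) (hα : α ∈ Set.Ico (0 : ℝ) 1) :
    P {ω | ((Finset.univ.filter fun j : Fin B => Y j ω ≤ Y ⟨0, hB⟩ ω).card : ℝ) ≤ α * B}
      ≤ (⌊α * B⌋₊ : ENNReal) / (B : ENNReal) := by
  have hαB : 0 ≤ α * B := mul_nonneg hα.1 B.cast_nonneg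
  simp only [← Nat.le_floor_iff hαB]
  generalize ⌊α * B⌋₊ = k
  let A : Fin B → Set Ω := fun i => {ω | (Finset.univ.filter fun j => Y j ω ≤ Y i ω).card ≤ k}
  have hA : ∀ i, MeasurableSet (A i) := fun i =>
    measurable_pi_lambda _ hmeas (measurableSet_card_filter_le i k)
  have hA_eq : ∀ i, P (A i) = P (A ⟨0, hB⟩) := by
    intro i
    let σ : Equiv.Perm (Fin B) := Equiv.swap ⟨0, hB⟩ i
    have hR := measurableSet_card_filter_le (⟨0, hB⟩ : Fin B) k
    have h := congrArg
      (fun μ => μ {y : Fin B → ℝ | (Finset.univ.filter fun j => y j ≤ y ⟨0, hB⟩).card ≤ k})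
      (hexch σ)
    simp only [Measure.map_apply (measurable_pi_lambda _ fun j => hmeas (σ j)) hR,
      Measure.map_apply (measurable_pi_lambda _ hmeas) hR] at h
    refine Eq.trans (congrArg P ?_) h
    ext ω
    have hcard : (Finset.univ.filter fun j => Y (σ j) ω ≤ Y i ω).card
        = (Finset.univ.filter fun j => Y j ω ≤ Y i ω).card := by
      simp only [Finset.card_filter]
      exact Equiv.sum_comp σ fun j => if Y j ω ≤ Y i ω then 1 else 0
    have hσ : σ ⟨0, hB⟩ = i := Equiv.swap_apply_left _ _
    simp only [A, Set.mem_preimage, Set.mem_ofPred_eq, hσ, hcard]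
  have hsum : ∑ i, P (A i) ≤ k := by
    classical
    refine sum_measure_le_of_card_filter_le P A hA k fun ω => ?_
    convert card_filter_card_filter_le_le (fun j => Y j ω) k
    exact Iff.rfl
  simp only [hA_eq, Finset.sum_const, Finset.card_univ, Fintype.card_fin, nsmul_eq_mul] at hsum
  refine (ENNReal.le_div_iff_mul_le (Or.inl ?_) (Or.inl (ENNReal.natCast_ne_top B))).2 ?_
  · exact_mod_cast (Nat.one_le_iff_ne_zero.mp hB)
  · rwa [mul_comm]
end
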